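/- Let K be a difference subfield of U with σ(K) = K, let a be a finite tuple with σ(a) ∈ K(a)^alg, and let d be a finite tuple with σ(d) ∈ K(d)^alg, K(d)^alg = K(a)^alg, and μ(σ(d)/K(d)) = ld(d/K). Then the following are equivalent: (i) ld(d/K) = dd(a/K); (iii) for every ℓ > 0, σ(d) ∈ K(d,σ^ℓ(d)); (iv) for every ℓ > 0, d ∈ K(σ^{-ℓ}(d),σ^ℓ(d)). -/

import Mathlib

/- Setting: a large algebraically closed field `U` with an automorphism `σ`.
   Tuples are maps `Fin n → U`; for a tuple `t`, the relevant set of coordinates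
   is `Set.range t`.  `fAdj E s` is the subfield `E(s)` generated by a subfield
   `E` and a set `s`, and `deg E s` is the degree `μ(s/E) = [E(s):E]`. -/

set_option maxHeartbeats 1000000
set_option synthInstance.maxHeartbeats 1000000

open Filter Set

variable {U : Type*}

/-- The subfield `E(s)` generated by the subfield `E` and the set `s`. -/
noncomputable def fAdj [Field U] (E : Subfield U) (s : Set U) : Subfield U :=
  (IntermediateField.adjoin E s).toSubfield

/-- The degree `μ(s/E) = [E(s):E]` (as `Module.finrank`; it is `0` when infinite). -/
noncomputable def deg [Field U] (E : Subfield U) (s : Set U) : ℕ :=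
  Module.finrank E (IntermediateField.adjoin E s)

/-- `k ↦ μ(σ^{k+1}(s) / K(s, σ(s), …, σ^k(s)))`: the sequence whose eventual
value is the limit degree `ld(s/K)`. -/
noncomputable def ldSeq [Field U] (σ : U ≃+* U) (K : Subfield U) (s : Set U) (k : ℕ) : ℕ :=
  deg (fAdj K (⋃ i ∈ Set.Iic k, ⇑(σ ^ i) '' s)) (⇑(σ ^ (k + 1)) '' s)

/-- `k ↦ μ(σ^k(s) / K(s))`: the sequence whose `k`-th roots converge to the
distant degree `dd(s/K)`. -/
noncomputable def ddSeq [Field U] (σ : U ≃+* U) (K : Subfield U) (s : Set U) (k : ℕ) : ℕ :=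
  deg (fAdj K s) (⇑(σ ^ k) '' s)

/-- The inversive closure `K^inv = ⋃ₙ σ^{-n}(K)`. -/
noncomputable def Kinv [Field U] (σ : U ≃+* U) (K : Subfield U) : Subfield U :=
  ⨆ n : ℕ, K.map (σ⁻¹ ^ n : U ≃+* U).toRingHom

/-- The difference field `K(s)_σ = K(σ^i(s) : i ∈ ℕ)` generated by `s` over `K`. -/
noncomputable def diffAdj [Field U] (σ : U ≃+* U) (K : Subfield U) (s : Set U) : Subfield U :=
  fAdj K (⋃ i : ℕ, ⇑(σ ^ i) '' s)

section RelativeDegree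

variable [Field U]

/-- The degree `[A(X) : A]` of the compositum of two subfields over the first one. -/
noncomputable def compDeg (A X : Subfield U) : ℕ := A.relfinrank (A ⊔ X)

theorem compDeg_le_of_le_left {A C : Subfield U} (X : Subfield U) (h : A ≤ C)
    (h0 : compDeg A X ≠ 0) : compDeg C X ≠ 0 ∧ compDeg C X ≤ compDeg A X := by
  have hAX : A ≤ A ⊔ X := le_sup_left
  have hCX : C ≤ C ⊔ X := le_sup_left
  unfold compDeg at h0 ⊢
  rw [Subfield.relfinrank_eq_finrank_of_le hAX] at h0 ⊢
  rw [Subfield.relfinrank_eq_finrank_of_le hCX]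
  let _ : Algebra A C := (Subfield.inclusion h).toAlgebra
  have _ : IsScalarTower A C U := IsScalarTower.of_algebraMap_eq' rfl
  have hfin : FiniteDimensional A (Subfield.extendScalars hAX) :=
    Module.finite_of_finrank_pos (Nat.pos_of_ne_zero h0)
  have key := IntermediateField.adjoin_rank_le_of_isAlgebraic_right C
    (Subfield.extendScalars hAX)
  have heq : IntermediateField.adjoin C ((Subfield.extendScalars hAX : IntermediateField A U) : Set U)
      = Subfield.extendScalars hCX := by
    apply le_antisymm
    · rw [IntermediateField.adjoin_le_iff]
      exact show A ⊔ X ≤ C ⊔ X from sup_le_sup_right h X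
    · rw [Subfield.extendScalars_le_iff]
      refine sup_le (fun x hx => ?_) (fun x hx => ?_)
      · exact (IntermediateField.adjoin C _).algebraMap_mem ⟨x, hx⟩
      · exact IntermediateField.subset_adjoin C _ (show x ∈ A ⊔ X from (le_sup_right : X ≤ _) hx)
  rw [heq] at key
  have hlt := Module.rank_lt_aleph0 A (Subfield.extendScalars hAX)
  have hfin' : FiniteDimensional C (Subfield.extendScalars hCX) :=
    Module.rank_lt_aleph0_iff.1 (key.trans_lt hlt)
  exact ⟨Module.finrank_pos.ne', Cardinal.toNat_le_toNat key hlt⟩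

theorem compDeg_sup (A X Y : Subfield U) :
    compDeg A (X ⊔ Y) = compDeg A X * compDeg (A ⊔ X) Y := by
  unfold compDeg
  rw [Subfield.relfinrank_mul_relfinrank le_sup_left le_sup_left, sup_assoc]

theorem compDeg_le_of_le_right {X Y : Subfield U} (A : Subfield U) (h : X ≤ Y)
    (h0 : compDeg A Y ≠ 0) : compDeg A X ≠ 0 ∧ compDeg A X ≤ compDeg A Y := by
  have := compDeg_sup A X Y
  rw [sup_eq_right.2 h] at this
  rw [this] at h0 ⊢
  exact ⟨left_ne_zero_of_mul h0, Nat.le_mul_of_pos_right _ (Nat.pos_of_ne_zero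
    (right_ne_zero_of_mul h0))⟩

theorem le_sup_of_compDeg_eq {A X Y : Subfield U} (h : X ≤ Y) (h0 : compDeg A Y ≠ 0)
    (heq : compDeg A X = compDeg A Y) : Y ≤ A ⊔ X := by
  have := compDeg_sup A X Y
  rw [sup_eq_right.2 h, heq] at this
  have h1 : compDeg (A ⊔ X) Y = 1 := by
    refine Nat.eq_of_mul_eq_mul_left (Nat.pos_of_ne_zero h0) ?_
    rw [← this, mul_one]
  exact le_sup_right.trans (Subfield.relfinrank_eq_one_iff.1 h1)

theorem compDeg_self (A : Subfield U) : compDeg A A = 1 := by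
  simp [compDeg]

theorem compDeg_sup_ne_zero {A X Y : Subfield U} (hX : compDeg A X ≠ 0) (hY : compDeg A Y ≠ 0) :
    compDeg A (X ⊔ Y) ≠ 0 ∧ compDeg A (X ⊔ Y) ≤ compDeg A X * compDeg A Y := by
  rw [compDeg_sup]
  obtain ⟨h1, h2⟩ := compDeg_le_of_le_left Y (le_sup_left : A ≤ A ⊔ X) hY
  exact ⟨mul_ne_zero hX h1, Nat.mul_le_mul_left _ h2⟩

end RelativeDegree

section Iterates

variable [Field U] (σ : U ≃+* U)

/-- The image of a subfield under the `k`-th iterate of `σ`. -/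
def iterMap (k : ℕ) (A : Subfield U) : Subfield U := A.map (σ ^ k : U ≃+* U).toRingHom

theorem mem_iterMap {k : ℕ} {A : Subfield U} {x : U} :
    x ∈ iterMap σ k A ↔ ∃ y ∈ A, (σ ^ k) y = x := Iff.rfl

theorem iterMap_zero (A : Subfield U) : iterMap σ 0 A = A := by
  ext x
  simp [mem_iterMap]

theorem iterMap_iterMap (m n : ℕ) (A : Subfield U) :
    iterMap σ m (iterMap σ n A) = iterMap σ (m + n) A := by
  ext x
  simp [mem_iterMap, pow_add]

theorem iterMap_sup (k : ℕ) (A B : Subfield U) :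
    iterMap σ k (A ⊔ B) = iterMap σ k A ⊔ iterMap σ k B := Subfield.map_sup _ _ _

theorem iterMap_mono {k : ℕ} {A B : Subfield U} (h : A ≤ B) : iterMap σ k A ≤ iterMap σ k B :=
  (Subfield.gc_map_comap _).monotone_l h

theorem iterMap_le_iterMap_iff {k : ℕ} {A B : Subfield U} :
    iterMap σ k A ≤ iterMap σ k B ↔ A ≤ B := by
  refine ⟨fun h x hx => ?_, iterMap_mono σ⟩
  obtain ⟨y, hy, hxy⟩ := h ⟨x, hx, rfl⟩
  exact (σ ^ k).injective hxy ▸ hy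

theorem compDeg_iterMap (k : ℕ) (A X : Subfield U) :
    compDeg (iterMap σ k A) (iterMap σ k X) = compDeg A X := by
  unfold compDeg
  rw [← iterMap_sup]
  exact Subfield.relfinrank_map_map _ _ _

theorem compDeg_iterMap_add {D : Subfield U} {m n : ℕ}
    (hm : compDeg D (iterMap σ m D) ≠ 0) (hn : compDeg D (iterMap σ n D) ≠ 0) :
    compDeg D (iterMap σ (m + n) D) ≠ 0 ∧
      compDeg D (iterMap σ (m + n) D) ≤
        compDeg D (iterMap σ m D) * compDeg D (iterMap σ n D) := by
  have h1 : compDeg (iterMap σ m D) (iterMap σ (m + n) D) = compDeg D (iterMap σ n D) := by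
    rw [← iterMap_iterMap, compDeg_iterMap]
  obtain ⟨h2, h3⟩ := compDeg_le_of_le_left (iterMap σ (m + n) D)
    (le_sup_right : iterMap σ m D ≤ D ⊔ iterMap σ m D) (h1 ▸ hn)
  have h4 := compDeg_sup D (iterMap σ m D) (iterMap σ (m + n) D)
  obtain ⟨h5, h6⟩ := compDeg_le_of_le_right D
    (le_sup_right : iterMap σ (m + n) D ≤ iterMap σ m D ⊔ iterMap σ (m + n) D)
    (h4 ▸ mul_ne_zero hm h2)
  refine ⟨h5, h6.trans ?_⟩
  rw [h4, ← h1]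
  exact Nat.mul_le_mul_left _ h3

theorem compDeg_iterMap_ne_zero {D : Subfield U} (h : compDeg D (iterMap σ 1 D) ≠ 0) (k : ℕ) :
    compDeg D (iterMap σ k D) ≠ 0 := by
  induction k with
  | zero => simp [iterMap_zero, compDeg_self]
  | succ k ih => exact (compDeg_iterMap_add σ ih h).1

theorem compDeg_iterMap_mul_le {D : Subfield U} (h : compDeg D (iterMap σ 1 D) ≠ 0) (l k : ℕ) :
    compDeg D (iterMap σ (l * k) D) ≤ compDeg D (iterMap σ l D) ^ k := by
  induction k with
  | zero => simp [iterMap_zero, compDeg_self]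
  | succ k ih =>
    rw [pow_succ, mul_add, mul_one]
    exact (compDeg_iterMap_add σ (compDeg_iterMap_ne_zero σ h _)
      (compDeg_iterMap_ne_zero σ h _)).2.trans (Nat.mul_le_mul_right _ ih)

theorem exists_compDeg_iterMap_le_mul {A D : Subfield U} (hA : compDeg A (iterMap σ 1 A) ≠ 0)
    (hAD : compDeg A D ≠ 0) (hDA : compDeg D A ≠ 0) :
    ∃ C : ℕ, 0 < C ∧ ∀ k, compDeg D (iterMap σ k D) ≤ C * compDeg A (iterMap σ k A) := by
  refine ⟨compDeg D A * (compDeg A D * compDeg A D), by positivity, fun k => ?_⟩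
  set A' := iterMap σ k A with hA'
  set D' := iterMap σ k D with hD'
  have hk : compDeg A A' ≠ 0 := compDeg_iterMap_ne_zero σ hA k
  have hAD' : compDeg A' D' = compDeg A D := compDeg_iterMap σ k A D
  obtain ⟨h1, h2⟩ := compDeg_le_of_le_left D (le_sup_left : A ≤ A ⊔ A') hAD
  obtain ⟨h3, h4⟩ := compDeg_le_of_le_left D' (le_sup_right : A' ≤ A ⊔ A') (hAD' ▸ hAD)
  obtain ⟨h5, h6⟩ := compDeg_sup_ne_zero h1 h3
  have h7 : compDeg A (A' ⊔ (D ⊔ D')) ≠ 0 := by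
    rw [compDeg_sup]
    exact mul_ne_zero hk h5
  obtain ⟨h8, h9⟩ := compDeg_le_of_le_right A
    (le_sup_right.trans le_sup_right : D' ≤ A' ⊔ (D ⊔ D')) h7
  obtain ⟨h10, h11⟩ := compDeg_le_of_le_left D' (le_sup_right : A ≤ D ⊔ A) h8
  have h12 : compDeg D (A ⊔ D') ≠ 0 := by
    rw [compDeg_sup]
    exact mul_ne_zero hDA h10
  calc compDeg D D' ≤ compDeg D (A ⊔ D') := (compDeg_le_of_le_right D le_sup_right h12).2
    _ = compDeg D A * compDeg (D ⊔ A) D' := compDeg_sup ..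
    _ ≤ compDeg D A * compDeg A (A' ⊔ (D ⊔ D')) := Nat.mul_le_mul_left _ (h11.trans h9)
    _ = compDeg D A * (compDeg A A' * compDeg (A ⊔ A') (D ⊔ D')) := by rw [compDeg_sup A A']
    _ ≤ compDeg D A * (compDeg A A' * (compDeg A D * compDeg A D)) := by
      gcongr
      exact h6.trans (Nat.mul_le_mul h2 (h4.trans hAD'.le))
    _ = _ := by ring

/-- The compositum of `D, σ(D), …, σ^k(D)`. -/
noncomputable def iterSup (D : Subfield U) (k : ℕ) : Subfield U :=
  partialSups (fun i => iterMap σ i D) k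

theorem iterSup_zero (D : Subfield U) : iterSup σ D 0 = D := by
  simp [iterSup, iterMap_zero]

theorem iterSup_succ (D : Subfield U) (k : ℕ) :
    iterSup σ D (k + 1) = iterSup σ D k ⊔ iterMap σ (k + 1) D := partialSups_succ _ _

theorem iterMap_le_iterSup (D : Subfield U) {i k : ℕ} (h : i ≤ k) :
    iterMap σ i D ≤ iterSup σ D k := le_partialSups_of_le (fun i => iterMap σ i D) h

theorem iterSup_le {D B : Subfield U} {k : ℕ} (h : ∀ i ≤ k, iterMap σ i D ≤ B) :
    iterSup σ D k ≤ B := partialSups_le _ _ _ h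

theorem iterMap_one_iterSup_le (D : Subfield U) (k : ℕ) :
    iterMap σ 1 (iterSup σ D k) ≤ iterSup σ D (k + 1) := by
  induction k with
  | zero =>
    rw [iterSup_zero]
    exact iterMap_le_iterSup σ D le_rfl
  | succ k ih =>
    rw [iterSup_succ, iterMap_sup, iterMap_iterMap, iterSup_succ σ D (k + 1), add_comm 1]
    exact sup_le_sup_right ih _

theorem compDeg_iterSup_antitone {D : Subfield U} (h : compDeg D (iterMap σ 1 D) ≠ 0) (k : ℕ) :
    compDeg (iterSup σ D k) (iterMap σ (k + 1) D) ≠ 0 ∧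
      compDeg (iterSup σ D (k + 1)) (iterMap σ (k + 1 + 1) D) ≤
        compDeg (iterSup σ D k) (iterMap σ (k + 1) D) := by
  have step (j : ℕ) (hj : compDeg (iterSup σ D j) (iterMap σ (j + 1) D) ≠ 0) :
      compDeg (iterSup σ D (j + 1)) (iterMap σ (j + 1 + 1) D) ≠ 0 ∧
        compDeg (iterSup σ D (j + 1)) (iterMap σ (j + 1 + 1) D) ≤
        compDeg (iterSup σ D j) (iterMap σ (j + 1) D) := by
    have h1 : compDeg (iterMap σ 1 (iterSup σ D j)) (iterMap σ (j + 1 + 1) D) =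
        compDeg (iterSup σ D j) (iterMap σ (j + 1) D) := by
      rw [add_comm (j + 1) 1, ← iterMap_iterMap, compDeg_iterMap]
    rw [← h1] at hj ⊢
    exact compDeg_le_of_le_left _ (iterMap_one_iterSup_le σ D j) hj
  have hne : ∀ j, compDeg (iterSup σ D j) (iterMap σ (j + 1) D) ≠ 0 := by
    intro j
    induction j with
    | zero => simpa [iterSup_zero] using h
    | succ j ih => exact (step j ih).1
  exact ⟨hne k, (step k (hne k)).2⟩

theorem compDeg_iterSup {D : Subfield U} {L : ℕ} (hL : compDeg D (iterMap σ 1 D) = L)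
    (hL0 : L ≠ 0)
    (hlim : ∀ᶠ k in atTop, compDeg (iterSup σ D k) (iterMap σ (k + 1) D) = L) (k : ℕ) :
    compDeg D (iterSup σ D k) = L ^ k := by
  have hanti : Antitone fun k => compDeg (iterSup σ D k) (iterMap σ (k + 1) D) :=
    antitone_nat_of_succ_le fun k => (compDeg_iterSup_antitone σ (hL ▸ hL0) k).2
  have hconst (j : ℕ) : compDeg (iterSup σ D j) (iterMap σ (j + 1) D) = L := by
    apply le_antisymm
    · have := hanti (Nat.zero_le j)
      simpa [iterSup_zero, hL] using this
    · obtain ⟨m, hm, hjm⟩ := (hlim.and (eventually_ge_atTop j)).exists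
      exact hm ▸ hanti hjm
  induction k with
  | zero => simp [iterSup_zero, compDeg_self]
  | succ k ih =>
    have h : D ⊔ iterSup σ D k = iterSup σ D k :=
      sup_eq_right.2 (by simpa [iterMap_zero] using iterMap_le_iterSup σ D (Nat.zero_le k))
    rw [iterSup_succ, compDeg_sup, ih, h, hconst, pow_succ]

theorem compDeg_iterMap_le_pow {D : Subfield U} {L : ℕ} (hL0 : L ≠ 0)
    (hE : ∀ k, compDeg D (iterSup σ D k) = L ^ k) (k : ℕ) :
    compDeg D (iterMap σ k D) ≠ 0 ∧ compDeg D (iterMap σ k D) ≤ L ^ k := by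
  rw [← hE k]
  exact compDeg_le_of_le_right D (iterMap_le_iterSup σ D le_rfl) (hE k ▸ pow_ne_zero k hL0)

theorem compDeg_iterMap_eq_pow_iff {D : Subfield U} {L : ℕ} (hL0 : L ≠ 0)
    (hE : ∀ k, compDeg D (iterSup σ D k) = L ^ k) (k : ℕ) :
    compDeg D (iterMap σ k D) = L ^ k ↔
      ∀ i ≤ k, iterMap σ i D ≤ D ⊔ iterMap σ k D := by
  constructor
  · intro h i hi
    exact (iterMap_le_iterSup σ D hi).trans (le_sup_of_compDeg_eq
      (iterMap_le_iterSup σ D le_rfl) (hE k ▸ pow_ne_zero k hL0) (h.trans (hE k).symm))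
  · intro h
    have h1 : D ⊔ iterMap σ k D = D ⊔ iterSup σ D k :=
      le_antisymm (sup_le_sup_left (iterMap_le_iterSup σ D le_rfl) _)
        (sup_le le_sup_left (iterSup_le σ h))
    rw [← hE k, compDeg, h1, compDeg]

theorem forall_compDeg_eq_pow_iff_one_le {D : Subfield U} {L : ℕ} (hL0 : L ≠ 0)
    (hE : ∀ k, compDeg D (iterSup σ D k) = L ^ k) :
    (∀ k, compDeg D (iterMap σ k D) = L ^ k) ↔
      ∀ l, 0 < l → iterMap σ 1 D ≤ D ⊔ iterMap σ l D := by
  constructor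
  · intro h l hl
    exact (compDeg_iterMap_eq_pow_iff σ hL0 hE l).1 (h l) 1 hl
  · intro h k
    rw [compDeg_iterMap_eq_pow_iff σ hL0 hE]
    induction k with
    | zero =>
      intro i hi
      rw [Nat.le_zero.1 hi]
      exact le_sup_right
    | succ k ih =>
      intro i hi
      rcases i with _ | i
      · simp [iterMap_zero]
      · have h1 := iterMap_mono σ (k := 1) (ih i (by omega))
        rw [iterMap_sup, iterMap_iterMap, iterMap_iterMap, add_comm 1, add_comm 1] at h1
        exact h1.trans (sup_le (h _ k.succ_pos) le_sup_right)

theorem forall_compDeg_eq_pow_iff_le_double {D : Subfield U} {L : ℕ} (hL0 : L ≠ 0)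
    (hE : ∀ k, compDeg D (iterSup σ D k) = L ^ k) :
    (∀ k, compDeg D (iterMap σ k D) = L ^ k) ↔
      ∀ l, 0 < l → iterMap σ l D ≤ D ⊔ iterMap σ (l + l) D := by
  constructor
  · intro h l hl
    exact (compDeg_iterMap_eq_pow_iff σ hL0 hE _).1 (h _) l (by omega)
  · intro h k
    have hpow (m : ℕ) : ∀ i ≤ 2 ^ m, iterMap σ i D ≤ D ⊔ iterMap σ (2 ^ m) D := by
      induction m with
      | zero =>
        intro i hi
        obtain rfl | rfl : i = 0 ∨ i = 1 := by simp at hi; omega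
        · simp [iterMap_zero]
        · exact le_sup_right
      | succ m ih =>
        have hm := h (2 ^ m) (by positivity)
        rw [pow_succ, mul_two]
        intro i hi
        rcases le_total i (2 ^ m) with him | him
        · exact (ih i him).trans (sup_le le_sup_left hm)
        · obtain ⟨j, rfl⟩ := Nat.exists_eq_add_of_le him
          have h1 := iterMap_mono σ (k := 2 ^ m) (ih j (by omega))
          rw [iterMap_sup, iterMap_iterMap, iterMap_iterMap] at h1
          exact h1.trans (sup_le hm le_sup_right)
    have hN := (compDeg_iterMap_eq_pow_iff σ hL0 hE (2 ^ k)).2 (hpow k)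
    obtain ⟨j, hj⟩ := Nat.exists_eq_add_of_le (Nat.lt_two_pow_self (n := k)).le
    rw [hj, pow_add] at hN
    obtain ⟨hk0, hk⟩ := compDeg_iterMap_le_pow σ hL0 hE k
    obtain ⟨hj0, hj⟩ := compDeg_iterMap_le_pow σ hL0 hE j
    refine hk.antisymm (Nat.le_of_mul_le_mul_right ?_ (pow_pos (Nat.pos_of_ne_zero hL0) j))
    exact hN ▸ (compDeg_iterMap_add σ hk0 hj0).2.trans (Nat.mul_le_mul_left _ hj)

end Iterates

section Growth

theorem tendsto_const_mul_pow_root {C s : ℝ} (hC : 0 < C) (hs : 0 ≤ s) :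
    Tendsto (fun k : ℕ => (C * s ^ k) ^ (1 / (k : ℝ))) atTop (nhds s) := by
  have h1 : Tendsto (fun k : ℕ => C ^ (1 / (k : ℝ)) * s) atTop (nhds s) := by
    have := (Real.continuousAt_const_rpow (b := 0) hC.ne').tendsto.comp
      (tendsto_one_div_atTop_nhds_zero_nat (𝕜 := ℝ))
    simpa using! this.mul_const s
  refine h1.congr' ?_
  filter_upwards [eventually_gt_atTop 0] with k hk
  rw [Real.mul_rpow hC.le (pow_nonneg hs k), one_div, Real.pow_rpow_inv_natCast hs hk.ne']

theorem root_limit_le {f : ℕ → ℕ} {R C s : ℝ} (hC : 0 < C) (hs : 0 ≤ s)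
    (hf : Tendsto (fun k => (f k : ℝ) ^ (1 / (k : ℝ))) atTop (nhds R))
    {φ : ℕ → ℕ} (hφ : Tendsto φ atTop atTop) (h : ∀ k, (f (φ k) : ℝ) ≤ C * s ^ φ k) : R ≤ s :=
  le_of_tendsto_of_tendsto' (hf.comp hφ) ((tendsto_const_mul_pow_root hC hs).comp hφ)
    fun k => Real.rpow_le_rpow (by positivity) (h k) (by positivity)

theorem le_root_limit {f : ℕ → ℕ} {R C s : ℝ} (hC : 0 < C) (hs : 0 ≤ s)
    (hf : Tendsto (fun k => (f k : ℝ) ^ (1 / (k : ℝ))) atTop (nhds R))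
    (h : ∀ k, C * s ^ k ≤ f k) : s ≤ R :=
  le_of_tendsto_of_tendsto' (tendsto_const_mul_pow_root hC hs) hf
    fun k => Real.rpow_le_rpow (by positivity) (h k) (by positivity)

theorem eq_root_limit_iff {f g : ℕ → ℕ} {L : ℕ} {R : ℝ} {C C' : ℕ} (hC : 0 < C) (hC' : 0 < C')
    (hf : Tendsto (fun k => (f k : ℝ) ^ (1 / (k : ℝ))) atTop (nhds R))
    (hfg : ∀ k, f k ≤ C * g k) (hgf : ∀ k, g k ≤ C' * f k)
    (hmul : ∀ l k, g (l * k) ≤ g l ^ k) (hgL : ∀ k, g k ≤ L ^ k) (hg0 : g 0 = 1) :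
    (L : ℝ) = R ↔ ∀ k, g k = L ^ k := by
  have hCR : (0 : ℝ) < C := by exact_mod_cast hC
  have hCR' : (0 : ℝ) < C' := by exact_mod_cast hC'
  constructor
  · intro hLR l
    rcases Nat.eq_zero_or_pos l with rfl | hl
    · simp [hg0]
    refine (hgL l).antisymm ?_
    have hs : (0 : ℝ) ≤ (g l : ℝ) ^ ((l : ℝ)⁻¹) := by positivity
    have hsl : ((g l : ℝ) ^ ((l : ℝ)⁻¹)) ^ l = g l :=
      Real.rpow_inv_natCast_pow (by positivity) hl.ne'
    have hle : R ≤ (g l : ℝ) ^ ((l : ℝ)⁻¹) := by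
      refine root_limit_le (φ := fun k => l * k) hCR hs hf
        (tendsto_id.const_mul_atTop' hl) fun k => ?_
      rw [pow_mul, hsl]
      exact_mod_cast (hfg _).trans (Nat.mul_le_mul_left _ (hmul l k))
    have := pow_le_pow_left₀ (Nat.cast_nonneg L) (hLR.le.trans hle) l
    rw [hsl] at this
    exact_mod_cast this
  · intro h
    apply le_antisymm
    · refine le_root_limit (inv_pos.2 hCR') (Nat.cast_nonneg L) hf fun k => ?_
      rw [inv_mul_le_iff₀ hCR']
      exact_mod_cast h k ▸ hgf k
    · refine root_limit_le hCR (Nat.cast_nonneg L) hf tendsto_id fun k => ?_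
      exact_mod_cast h k ▸ hfg k

end Growth

section Adjoin

variable [Field U]

theorem fAdj_le_iff {K B : Subfield U} {s : Set U} : fAdj K s ≤ B ↔ K ≤ B ∧ s ⊆ B := by
  have hrange : Set.range (algebraMap K U) = (K : Set U) := Subtype.range_coe
  rw [fAdj, IntermediateField.adjoin_toSubfield, Subfield.closure_le, hrange, Set.union_subset_iff]
  rfl

theorem le_fAdj (K : Subfield U) (s : Set U) : K ≤ fAdj K s := (fAdj_le_iff.1 le_rfl).1

theorem subset_fAdj (K : Subfield U) (s : Set U) : s ⊆ fAdj K s := (fAdj_le_iff.1 le_rfl).2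

theorem fAdj_union (K : Subfield U) (s t : Set U) : fAdj K (s ∪ t) = fAdj K s ⊔ fAdj K t := by
  refine eq_of_forall_ge_iff fun B => ?_
  simp only [sup_le_iff, fAdj_le_iff, Set.union_subset_iff]
  tauto

theorem fAdj_fAdj (K : Subfield U) (s t : Set U) :
    fAdj (fAdj K s) t = fAdj K s ⊔ fAdj K t := by
  refine eq_of_forall_ge_iff fun B => ?_
  simp only [sup_le_iff, fAdj_le_iff]
  tauto

theorem deg_eq_relfinrank (K : Subfield U) (s : Set U) : deg K s = K.relfinrank (fAdj K s) := by
  rw [Subfield.relfinrank_eq_finrank_of_le (le_fAdj K s)]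
  rfl

theorem deg_fAdj (K : Subfield U) (s t : Set U) :
    deg (fAdj K s) t = compDeg (fAdj K s) (fAdj K t) := by
  rw [deg_eq_relfinrank, fAdj_fAdj, compDeg]

theorem compDeg_fAdj_ne_zero {K : Subfield U} {s t : Set U} (ht : t.Finite)
    (h : ∀ x ∈ t, IsAlgebraic (fAdj K s) x) : compDeg (fAdj K s) (fAdj K t) ≠ 0 := by
  rw [← deg_fAdj]
  have := ht.to_subtype
  have := IntermediateField.finiteDimensional_adjoin fun x hx => (h x hx).isIntegral
  exact Module.finrank_pos.ne'

variable {σ : U ≃+* U} {K : Subfield U}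

theorem iterMap_eq_self (hK : K.map σ.toRingHom = K) (k : ℕ) : iterMap σ k K = K := by
  induction k with
  | zero => exact iterMap_zero σ K
  | succ k ih =>
    have h1 : iterMap σ 1 K = K := by rw [iterMap, pow_one, hK]
    rw [← iterMap_iterMap, h1, ih]

theorem iterMap_fAdj (hK : K.map σ.toRingHom = K) (s : Set U) (k : ℕ) :
    iterMap σ k (fAdj K s) = fAdj K (⇑(σ ^ k) '' s) := by
  refine eq_of_forall_ge_iff fun B => ?_
  rw [iterMap, Subfield.map_le_iff_le_comap, fAdj_le_iff, fAdj_le_iff,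
    ← Subfield.map_le_iff_le_comap, ← iterMap, iterMap_eq_self hK, Set.image_subset_iff]
  rfl

theorem ddSeq_eq_compDeg (hK : K.map σ.toRingHom = K) (s : Set U) (k : ℕ) :
    ddSeq σ K s k = compDeg (fAdj K s) (iterMap σ k (fAdj K s)) := by
  rw [ddSeq, deg_fAdj, iterMap_fAdj hK]

theorem fAdj_iUnion_Iic (hK : K.map σ.toRingHom = K) (s : Set U) (k : ℕ) :
    fAdj K (⋃ i ∈ Set.Iic k, ⇑(σ ^ i) '' s) = iterSup σ (fAdj K s) k := by
  refine eq_of_forall_ge_iff fun B => ?_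
  simp only [fAdj_le_iff, iterSup, partialSups_le_iff, iterMap_fAdj hK, Set.iUnion_subset_iff,
    Set.mem_Iic]
  exact ⟨fun h i hi => ⟨h.1, h.2 i hi⟩, fun h => ⟨(h 0 k.zero_le).1, fun i hi => (h i hi).2⟩⟩

theorem ldSeq_eq_compDeg (hK : K.map σ.toRingHom = K) (s : Set U) (k : ℕ) :
    ldSeq σ K s k = compDeg (iterSup σ (fAdj K s) k) (iterMap σ (k + 1) (fAdj K s)) := by
  rw [ldSeq, deg_fAdj, fAdj_iUnion_Iic hK, iterMap_fAdj hK]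

theorem forall_mem_fAdj_iff {r : ℕ} {d : Fin r → U} (τ : U → U) {s : Set U} :
    (∀ i, τ (d i) ∈ fAdj K s) ↔ fAdj K (τ '' Set.range d) ≤ fAdj K s := by
  rw [fAdj_le_iff, and_iff_right (le_fAdj K s), Set.image_subset_iff, Set.range_subset_iff]
  rfl

end Adjoin

/-- for `d` equi-algebraic with `a` over `K` with
`μ(σ(d)/K(d)) = ld(d/K)`, the conditions (i) `ld(d/K) = dd(a/K)`,
(iii) `σ(d) ∈ K(d,σ^ℓ(d))` for all `ℓ > 0`, and
(iv) `d ∈ K(σ^{-ℓ}(d),σ^ℓ(d))` for all `ℓ > 0`, are equivalent. -/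
theorem stmt9 [Field U] [IsAlgClosed U] (σ : U ≃+* U) (K : Subfield U)
    (hK : K.map σ.toRingHom = K) {n r : ℕ} (a : Fin n → U) (d : Fin r → U)
    (ha : ∀ i, IsAlgebraic (fAdj K (Set.range a)) (σ (a i)))
    (hd : ∀ i, IsAlgebraic (fAdj K (Set.range d)) (σ (d i)))
    (heq : ∀ x : U, IsAlgebraic (fAdj K (Set.range a)) x ↔
      IsAlgebraic (fAdj K (Set.range d)) x)
    (Ld : ℕ) (hLd : ∀ᶠ k in atTop, ldSeq σ K (Set.range d) k = Ld)
    (hmud : deg (fAdj K (Set.range d)) (⇑σ '' Set.range d) = Ld)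
    (Da : ℝ)
    (hDa : Tendsto (fun k => (ddSeq σ K (Set.range a) k : ℝ) ^ (1 / (k : ℝ))) atTop (nhds Da)) :
    (((Ld : ℝ) = Da) ↔
      (∀ ℓ : ℕ, 0 < ℓ → ∀ i,
        σ (d i) ∈ fAdj K (Set.range d ∪ ⇑(σ ^ ℓ) '' Set.range d))) ∧
    ((∀ ℓ : ℕ, 0 < ℓ → ∀ i,
        σ (d i) ∈ fAdj K (Set.range d ∪ ⇑(σ ^ ℓ) '' Set.range d)) ↔
      (∀ ℓ : ℕ, 0 < ℓ → ∀ i,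
        d i ∈ fAdj K (⇑(σ⁻¹ ^ ℓ) '' Set.range d ∪ ⇑(σ ^ ℓ) '' Set.range d))) := by
  set D := fAdj K (Set.range d) with hD
  set A := fAdj K (Set.range a) with hA
  have halgA (x : U) (hx : x ∈ A) : IsAlgebraic A x := isAlgebraic_algebraMap (⟨x, hx⟩ : A)
  have halgD (x : U) (hx : x ∈ D) : IsAlgebraic D x := isAlgebraic_algebraMap (⟨x, hx⟩ : D)
  have hσA : compDeg A (iterMap σ 1 A) ≠ 0 := by
    rw [hA, iterMap_fAdj hK, pow_one]
    refine compDeg_fAdj_ne_zero ((Set.finite_range a).image _) ?_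
    rintro _ ⟨_, ⟨i, rfl⟩, rfl⟩
    exact ha i
  have hσD : compDeg D (iterMap σ 1 D) ≠ 0 := by
    rw [hD, iterMap_fAdj hK, pow_one]
    refine compDeg_fAdj_ne_zero ((Set.finite_range d).image _) ?_
    rintro _ ⟨_, ⟨i, rfl⟩, rfl⟩
    exact hd i
  have hAD : compDeg A D ≠ 0 := compDeg_fAdj_ne_zero (Set.finite_range d)
    fun x hx => (heq x).2 (halgD x (subset_fAdj K _ hx))
  have hDA : compDeg D A ≠ 0 := compDeg_fAdj_ne_zero (Set.finite_range a)
    fun x hx => (heq x).1 (halgA x (subset_fAdj K _ hx))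
  have hL : compDeg D (iterMap σ 1 D) = Ld := by
    rw [← hmud, hD, deg_fAdj, iterMap_fAdj hK, pow_one]
  have hL0 : Ld ≠ 0 := hL ▸ hσD
  have hE := compDeg_iterSup σ hL hL0 (hLd.mono fun k hk => (ldSeq_eq_compDeg hK _ k).symm.trans hk)
  obtain ⟨C, hC, hfg⟩ := exists_compDeg_iterMap_le_mul σ hσD hDA hAD
  obtain ⟨C', hC', hgf⟩ := exists_compDeg_iterMap_le_mul σ hσA hAD hDA
  simp only [ddSeq_eq_compDeg hK] at hDa
  have hi := eq_root_limit_iff hC hC' hDa hfg hgf (compDeg_iterMap_mul_le σ hσD)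
    (fun k => (compDeg_iterMap_le_pow σ hL0 hE k).2) (by rw [iterMap_zero, compDeg_self])
  have hiii : (∀ ℓ : ℕ, 0 < ℓ → ∀ i,
      σ (d i) ∈ fAdj K (Set.range d ∪ ⇑(σ ^ ℓ) '' Set.range d)) ↔
      ∀ l, 0 < l → iterMap σ 1 D ≤ D ⊔ iterMap σ l D := by
    refine forall₂_congr fun l _ => ?_
    rw [forall_mem_fAdj_iff σ, fAdj_union, ← iterMap_fAdj hK, hD, iterMap_fAdj hK _ 1, pow_one]
  have hiv : (∀ ℓ : ℕ, 0 < ℓ → ∀ i,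
      d i ∈ fAdj K (⇑(σ⁻¹ ^ ℓ) '' Set.range d ∪ ⇑(σ ^ ℓ) '' Set.range d)) ↔
      ∀ l, 0 < l → iterMap σ l D ≤ D ⊔ iterMap σ (l + l) D := by
    refine forall₂_congr fun l _ => ?_
    have hinv : iterMap σ l (fAdj K (⇑(σ⁻¹ ^ l) '' Set.range d)) = D := by
      rw [iterMap_fAdj hK, Set.image_image]
      have hcancel (x : U) : (σ ^ l) ((σ⁻¹ ^ l) x) = x := by
        rw [inv_pow, ← RingAut.mul_apply, mul_inv_cancel, RingAut.one_apply]
      simp only [hcancel, Set.image_id', hD]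
    refine (forall_mem_fAdj_iff id).trans ?_
    rw [Set.image_id, fAdj_union, ← iterMap_le_iterMap_iff σ (k := l), iterMap_sup, hinv,
      ← iterMap_fAdj hK, iterMap_iterMap]
  rw [hiii, hiv, hi, ← forall_compDeg_eq_pow_iff_one_le σ hL0 hE,
    ← forall_compDeg_eq_pow_iff_le_double σ hL0 hE]
  exact ⟨Iff.rfl, Iff.rfl⟩
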